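/- Every graph with infinitely many vertices has an ℵ₀-tangle. -/

import Mathlib

open Set

variable {V : Type*}

/-- `{A,B}` is a separation of `G`: `A ∪ B = V` and no edge between `A∖B` and `B∖A`. -/
def IsSep (G : SimpleGraph V) (A B : Set V) : Prop :=
  A ∪ B = Set.univ ∧ ∀ a ∈ A \ B, ∀ b ∈ B \ A, ¬ G.Adj a b

/-- A separation of finite order. -/
def IsFinSep (G : SimpleGraph V) (A B : Set V) : Prop :=
  IsSep G A B ∧ (A ∩ B).Finite

/-- The set `S⃗` of oriented finite-order separations of `G`, as ordered pairs. -/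
def Svec (G : SimpleGraph V) : Set (Set V × Set V) :=
  {p | IsFinSep G p.1 p.2}

/-- `(A,B) ≤ (C,D)` iff `A ⊆ C` and `D ⊆ B`. -/
def sepLE (p q : Set V × Set V) : Prop :=
  p.1 ⊆ q.1 ∧ q.2 ⊆ p.2

/-- An orientation of the set `S` of finite-order separations: a subset of `S⃗` containing
exactly one of `(A,B)`, `(B,A)` for every finite-order separation `{A,B}`. -/
def IsOrientation (G : SimpleGraph V) (O : Set (Set V × Set V)) : Prop :=
  O ⊆ Svec G ∧ ∀ A B : Set V, IsFinSep G A B → ((A, B) ∈ O ↔ (B, A) ∉ O)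

/-- Consistency: no two distinct members `(B,A)`, `(C,D)` with `(A,B) < (C,D)`. -/
def Consistent (O : Set (Set V × Set V)) : Prop :=
  ∀ A B C D : Set V, (B, A) ∈ O → (C, D) ∈ O → (B, A) ≠ (C, D) →
    ¬ (sepLE (A, B) (C, D) ∧ (A, B) ≠ (C, D))

/-- A star in `S⃗`: every two distinct elements point towards each other. -/
def IsStar (G : SimpleGraph V) (σ : Set (Set V × Set V)) : Prop :=
  σ ⊆ Svec G ∧ ∀ p ∈ σ, ∀ q ∈ σ, p ≠ q → sepLE p (q.2, q.1)

/-- Membership in `T_n`: a star of at most `n` elements whose target sides have finite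
intersection. -/
def InTn (G : SimpleGraph V) (n : ℕ) (σ : Set (Set V × Set V)) : Prop :=
  IsStar G σ ∧ σ.Finite ∧ σ.ncard ≤ n ∧ (⋂ p ∈ σ, p.2).Finite

/-- Membership in `T`: an arbitrary star whose target sides have finite intersection. -/
def InT (G : SimpleGraph V) (σ : Set (Set V × Set V)) : Prop :=
  IsStar G σ ∧ (⋂ p ∈ σ, p.2).Finite

/-- An `ℵ₀`-tangle of `G`: a consistent orientation of `S` with no subset in `T₃`. -/
def IsTangle (G : SimpleGraph V) (τ : Set (Set V × Set V)) : Prop :=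
  IsOrientation G τ ∧ Consistent τ ∧ ∀ σ ⊆ τ, ¬ InTn G 3 σ

/-- A `T`-tangle of `S`: a consistent orientation of `S` with no subset in `T`. -/
def IsTTangle (G : SimpleGraph V) (τ : Set (Set V × Set V)) : Prop :=
  IsOrientation G τ ∧ Consistent τ ∧ ∀ σ ⊆ τ, ¬ InT G σ

/-- The set `𝒞_X` of (vertex sets of) connected components of `G − X`. -/
def Comps (G : SimpleGraph V) (X : Set V) : Set (Set V) :=
  {C | ∃ c : (G.induce Xᶜ).ConnectedComponent, C = Subtype.val '' c.supp}

/-- A collection of subsets of `α` is an ultrafilter on `α`. -/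
def IsUltra {α : Type*} (F : Set (Set α)) : Prop :=
  ∅ ∉ F ∧ (∀ s ∈ F, ∀ t ∈ F, s ∩ t ∈ F) ∧ (∀ s ∈ F, ∀ t : Set α, s ⊆ t → t ∈ F) ∧
    ∀ s : Set α, s ∈ F ∨ sᶜ ∈ F

/-- A principal ultrafilter, generated by a single point. -/
def IsPrincipalUF {α : Type*} (F : Set (Set α)) : Prop :=
  ∃ a : α, F = {s | a ∈ s}

/-- `U(τ,X)`: the collection of all sets `𝒮` of components of `G − X` with
`(⋃(𝒞_X∖𝒮) ∪ X, ⋃𝒮 ∪ X) ∈ τ`. -/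
def tangleUF (G : SimpleGraph V) (τ : Set (Set V × Set V)) (X : Set V) :
    Set (Set ↥(Comps G X)) :=
  {𝒮 | ((⋃ C ∈ 𝒮ᶜ, (C : Set V)) ∪ X, (⋃ C ∈ 𝒮, (C : Set V)) ∪ X) ∈ τ}

/-- `f_{X',X}`: the pushforward of an ultrafilter on `𝒞_{X'}` along the map sending each
component of `G − X'` to the component of `G − X` containing it. -/
def pushUF (G : SimpleGraph V) (X X' : Set V) (F : Set (Set ↥(Comps G X'))) :
    Set (Set ↥(Comps G X)) :=
  {𝒮 | {C' : ↥(Comps G X') | ∃ C ∈ 𝒮, (C' : Set V) ⊆ (C : Set V)} ∈ F}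

/-- A direction in `G`: a choice of a component of `G − X` for every finite `X ⊆ V`,
compatible under inclusion. -/
def IsDirection (G : SimpleGraph V) (f : Set V → Set V) : Prop :=
  (∀ X : Set V, X.Finite → f X ∈ Comps G X) ∧
    ∀ X X' : Set V, X.Finite → X'.Finite → X ⊆ X' → f X' ⊆ f X

theorem infinite_of_mem_hyperfilter {α : Type*} [Infinite α] {s : Set α}
    (hs : s ∈ Filter.hyperfilter α) : s.Infinite :=
  fun hfin => Filter.notMem_hyperfilter_of_finite hfin hs

/-- A nonprincipal ultrafilter on the vertices orients every finite-order separation towards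
its side in the ultrafilter. -/
def hyperfilterOrientation [Infinite V] (G : SimpleGraph V) : Set (Set V × Set V) :=
  {p | IsFinSep G p.1 p.2 ∧ p.2 ∈ Filter.hyperfilter V}

theorem IsFinSep.symm {G : SimpleGraph V} {A B : Set V} (h : IsFinSep G A B) :
    IsFinSep G B A :=
  ⟨⟨by rw [union_comm]; exact h.1.1, fun b hb a ha hab => h.1.2 a ha b hb hab.symm⟩,
    by rw [inter_comm]; exact h.2⟩

theorem isOrientation_hyperfilterOrientation [Infinite V] (G : SimpleGraph V) :
    IsOrientation G (hyperfilterOrientation G) := by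
  refine ⟨fun p hp => hp.1, fun A B h => ⟨fun hAB hBA => ?_, fun hBA => ⟨h, ?_⟩⟩⟩
  · exact infinite_of_mem_hyperfilter (Filter.inter_mem hBA.2 hAB.2) h.2
  · have hU : A ∪ B ∈ Filter.hyperfilter V := by rw [h.1.1]; exact Filter.univ_mem
    exact (Ultrafilter.union_mem_iff.1 hU).resolve_left fun hA => hBA ⟨h.symm, hA⟩

theorem consistent_hyperfilterOrientation [Infinite V] (G : SimpleGraph V) :
    Consistent (hyperfilterOrientation G) := by
  intro A B C D hBA hCD _ hlt
  have hC : C ∈ Filter.hyperfilter V := Filter.mem_of_superset hBA.2 hlt.1.1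
  exact infinite_of_mem_hyperfilter (Filter.inter_mem hC hCD.2) hCD.1.2

/-- Proposition 4.2: every graph with infinitely many vertices has an
`ℵ₀`-tangle. -/
theorem stmt17 (V : Type*) [Infinite V] (G : SimpleGraph V) :
    ∃ τ : Set (Set V × Set V), IsTangle G τ := by
  refine ⟨hyperfilterOrientation G, isOrientation_hyperfilterOrientation G,
    consistent_hyperfilterOrientation G, fun σ hσ ⟨_, hfin, _, hinter⟩ => ?_⟩
  exact infinite_of_mem_hyperfilter
    ((Filter.biInter_mem hfin).2 fun p hp => (hσ hp).2) hinter
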